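/- arXiv:gr-qc/0410126 — 8 statements merged into one kernel-verified Lean document; each statement's English description precedes it below -/
import Mathlib

section
/- For every twice continuously differentiable function f : ℝ → ℝ, the Wainwright–Marshman functions E(t,x) = e^{2t}, Σ₋(t,x) = −1/(2√3), N_×(t,x) = 0, Σ_×(t,x) = (1/√3)·e^t·f'(e^{2t}−2x), N₋(t,x) = −(1/√3)·e^t·f'(e^{2t}−2x) satisfy all five equations of the vacuum orthogonally transitive G₂ evolution system at every point (t,x) ∈ ℝ². -/
/-- The Wainwright–Marshman functions solve all five equations of the vacuum
orthogonally transitive `G₂` evolution system. -/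
theorem wainwright_marshman_solves_vacuum_OT_G2
    (f : ℝ → ℝ) (hf : ContDiff ℝ 2 f)
    (E Sm Nc Sc Nm : ℝ → ℝ → ℝ)
    (hE : ∀ t x : ℝ, E t x = Real.exp (2 * t))
    (hSm : ∀ t x : ℝ, Sm t x = -(1 / (2 * Real.sqrt 3)))
    (hNc : ∀ t x : ℝ, Nc t x = 0)
    (hSc : ∀ t x : ℝ,
      Sc t x = (1 / Real.sqrt 3) * Real.exp t * deriv f (Real.exp (2 * t) - 2 * x))
    (hNm : ∀ t x : ℝ,
      Nm t x = -((1 / Real.sqrt 3) * Real.exp t * deriv f (Real.exp (2 * t) - 2 * x))) :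
    ∀ t x : ℝ,
      deriv (fun s => E s x) t = 2 * E t x ∧
      deriv (fun s => Sm s x) t + E t x * deriv (fun y => Nc t y) x
        = 2 * Real.sqrt 3 * ((Sc t x) ^ 2 - (Nm t x) ^ 2) ∧
      deriv (fun s => Nc s x) t + E t x * deriv (fun y => Sm t y) x = 2 * Nc t x ∧
      deriv (fun s => Sc s x) t - E t x * deriv (fun y => Nm t y) x
        = -(2 * Real.sqrt 3) * (Nm t x * Nc t x + Sm t x * Sc t x) ∧
      deriv (fun s => Nm s x) t - E t x * deriv (fun y => Sc t y) x
        = 2 * Nm t x + 2 * Real.sqrt 3 * (Sm t x * Nm t x + Nc t x * Sc t x) := by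
  intro t x
  have hf' : Differentiable ℝ (deriv f) := by
    have h : ContDiff ℝ (1 + 1) f := by simpa [one_add_one_eq_two] using hf
    exact (contDiff_succ_iff_deriv.mp h).2.2.differentiable one_ne_zero
  have h3 : Real.sqrt 3 ≠ 0 := by positivity
  have hexp : HasDerivAt (fun s : ℝ => Real.exp (2 * s)) (Real.exp (2 * t) * 2) t := by
    simpa using ((hasDerivAt_id t).const_mul 2).exp
  set d := deriv (deriv f) (Real.exp (2 * t) - 2 * x)
  have hd : HasDerivAt (deriv f) d (Real.exp (2 * t) - 2 * x) := (hf' _).hasDerivAt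
  have ht : HasDerivAt (fun s => 1 / Real.sqrt 3 * Real.exp s * deriv f (Real.exp (2 * s) - 2 * x))
      (1 / Real.sqrt 3 * Real.exp t * deriv f (Real.exp (2 * t) - 2 * x) +
        1 / Real.sqrt 3 * Real.exp t * (d * (Real.exp (2 * t) * 2))) t :=
    ((Real.hasDerivAt_exp t).const_mul (1 / Real.sqrt 3)).fun_mul
      (HasDerivAt.comp (h₂ := deriv f) (h := fun s => Real.exp (2 * s) - 2 * x) t hd
        (hexp.sub_const (2 * x)))
  have hlin : HasDerivAt (fun y : ℝ => Real.exp (2 * t) - 2 * y) (-2) x := by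
    simpa using ((hasDerivAt_id x).const_mul 2).const_sub (Real.exp (2 * t))
  have hx : HasDerivAt (fun y => 1 / Real.sqrt 3 * Real.exp t * deriv f (Real.exp (2 * t) - 2 * y))
      (1 / Real.sqrt 3 * Real.exp t * (d * (-2))) x :=
    (HasDerivAt.comp (h₂ := deriv f) (h := fun y => Real.exp (2 * t) - 2 * y) x hd hlin).const_mul
      (1 / Real.sqrt 3 * Real.exp t)
  simp only [hE, hSm, hNc, hSc, hNm]
  have htn := ht.fun_neg.deriv
  have hxn := hx.fun_neg.deriv
  rw [hexp.deriv, ht.deriv, htn, hx.deriv, hxn]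
  simp only [deriv_const]
  refine ⟨by ring, by ring, by ring, ?_, ?_⟩ <;> field_simp <;> ring
end

section
/- Gowdy-to-Ernst transformation: if differentiable functions E, Σ₋, N_×, Σ_×, N₋ : ℝ² → ℝ satisfy the four shear/curvature equations of the vacuum orthogonally transitive G₂ evolution system (the equations for ∂ₜΣ₋, ∂ₜN_×, ∂ₜΣ_×, ∂ₜN₋), then the transformed functions Σ̂₋ = −Σ₋ − 1/√3, N̂_× = −N_×, Σ̂_× = N₋, N̂₋ = Σ_× satisfy the same four equations with the same function E. -/
/-- Gowdy-to-Ernst transformation: if `E, Σ₋, N_×, Σ_×, N₋` satisfy the four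
shear/curvature equations of the vacuum orthogonally transitive `G₂` evolution system,
then so do the transformed functions `Σ̂₋ = −Σ₋ − 1/√3`, `N̂_× = −N_×`, `Σ̂_× = N₋`,
`N̂₋ = Σ_×`, with the same `E`. -/
theorem gowdy_to_ernst_transformation
    (E Sm Nc Sc Nm : ℝ → ℝ → ℝ)
    (hEdiff : Differentiable ℝ (Function.uncurry E))
    (hSmdiff : Differentiable ℝ (Function.uncurry Sm))
    (hNcdiff : Differentiable ℝ (Function.uncurry Nc))
    (hScdiff : Differentiable ℝ (Function.uncurry Sc))
    (hNmdiff : Differentiable ℝ (Function.uncurry Nm))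
    (heq1 : ∀ t x : ℝ, deriv (fun s => Sm s x) t + E t x * deriv (fun y => Nc t y) x
        = 2 * Real.sqrt 3 * ((Sc t x) ^ 2 - (Nm t x) ^ 2))
    (heq2 : ∀ t x : ℝ, deriv (fun s => Nc s x) t + E t x * deriv (fun y => Sm t y) x
        = 2 * Nc t x)
    (heq3 : ∀ t x : ℝ, deriv (fun s => Sc s x) t - E t x * deriv (fun y => Nm t y) x
        = -(2 * Real.sqrt 3) * (Nm t x * Nc t x + Sm t x * Sc t x))
    (heq4 : ∀ t x : ℝ, deriv (fun s => Nm s x) t - E t x * deriv (fun y => Sc t y) x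
        = 2 * Nm t x + 2 * Real.sqrt 3 * (Sm t x * Nm t x + Nc t x * Sc t x))
    (Smh Nch Sch Nmh : ℝ → ℝ → ℝ)
    (hSmh : ∀ t x : ℝ, Smh t x = -Sm t x - 1 / Real.sqrt 3)
    (hNch : ∀ t x : ℝ, Nch t x = -Nc t x)
    (hSch : ∀ t x : ℝ, Sch t x = Nm t x)
    (hNmh : ∀ t x : ℝ, Nmh t x = Sc t x) :
    ∀ t x : ℝ,
      deriv (fun s => Smh s x) t + E t x * deriv (fun y => Nch t y) x
        = 2 * Real.sqrt 3 * ((Sch t x) ^ 2 - (Nmh t x) ^ 2) ∧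
      deriv (fun s => Nch s x) t + E t x * deriv (fun y => Smh t y) x = 2 * Nch t x ∧
      deriv (fun s => Sch s x) t - E t x * deriv (fun y => Nmh t y) x
        = -(2 * Real.sqrt 3) * (Nmh t x * Nch t x + Smh t x * Sch t x) ∧
      deriv (fun s => Nmh s x) t - E t x * deriv (fun y => Sch t y) x
        = 2 * Nmh t x + 2 * Real.sqrt 3 * (Smh t x * Nmh t x + Nch t x * Sch t x) := by
  intro t x
  have hsqrt : Real.sqrt 3 * (1 / Real.sqrt 3) = 1 :=
    mul_one_div_cancel (Real.sqrt_ne_zero'.mpr (by norm_num))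
  simp only [hSmh, hNch, hSch, hNmh, deriv_sub_const, deriv.fun_neg]
  refine ⟨?_, ?_, ?_, ?_⟩
  · linear_combination -heq1 t x
  · linear_combination -heq2 t x
  · linear_combination heq4 t x - 2 * Nm t x * hsqrt
  · linear_combination heq3 t x + 2 * Sc t x * hsqrt
end

section
/- For every twice continuously differentiable function f : ℝ → ℝ, the transformed Wainwright–Marshman functions Σ̃₋, Ñ_×, Σ̃_×, Ñ₋ together with E(t,x) = e^{2t} satisfy, at every point (t,x) ∈ ℝ², the four shear/curvature equations of the vacuum orthogonally transitive G₂ evolution system (the equations for ∂ₜΣ₋, ∂ₜN_×, ∂ₜΣ_×, ∂ₜN₋). -/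
/-- Derivative of `(p² - 1) / (p² + 1)`, expressed through the pair
`c = (p² - 1) / (p² + 1)`, `s = 2 p / (p² + 1)`. -/
theorem HasDerivAt.sq_sub_one_div_sq_add_one {p : ℝ → ℝ} {p' u : ℝ} (hp : HasDerivAt p p' u) :
    HasDerivAt (fun v => (p v ^ 2 - 1) / (p v ^ 2 + 1))
      (2 * p u / (p u ^ 2 + 1) * (1 - (p u ^ 2 - 1) / (p u ^ 2 + 1)) * p') u := by
  have h0 : p u ^ 2 + 1 ≠ 0 := by positivity
  refine (((hp.fun_pow 2).sub_const 1).fun_div ((hp.fun_pow 2).add_const 1) h0).congr_deriv ?_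
  field_simp
  ring

/-- Derivative of `2 p / (p² + 1)`, expressed through `c = (p² - 1) / (p² + 1)`. -/
theorem HasDerivAt.two_mul_div_sq_add_one {p : ℝ → ℝ} {p' u : ℝ} (hp : HasDerivAt p p' u) :
    HasDerivAt (fun v => 2 * p v / (p v ^ 2 + 1))
      (-((p u ^ 2 - 1) / (p u ^ 2 + 1) * (1 - (p u ^ 2 - 1) / (p u ^ 2 + 1))) * p') u := by
  have h0 : p u ^ 2 + 1 ≠ 0 := by positivity
  refine ((hp.const_mul 2).fun_div ((hp.fun_pow 2).add_const 1) h0).congr_deriv ?_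
  field_simp
  ring


/-- The transformed Wainwright–Marshman functions, together with `E(t,x) = e^{2t}`,
satisfy the four shear/curvature equations of the vacuum orthogonally transitive
`G₂` evolution system. -/
theorem transformed_wainwright_marshman_solves_vacuum_OT_G2
    (f : ℝ → ℝ) (hf : ContDiff ℝ 2 f)
    (F G c s E Sm Nc Sc Nm : ℝ → ℝ → ℝ)
    (hF : ∀ t x : ℝ, F t x = f (Real.exp (2 * t) - 2 * x))
    (hG : ∀ t x : ℝ, G t x = Real.exp t * deriv f (Real.exp (2 * t) - 2 * x))
    (hc : ∀ t x : ℝ, c t x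
      = ((F t x * Real.exp (-t)) ^ 2 - 1) / ((F t x * Real.exp (-t)) ^ 2 + 1))
    (hs : ∀ t x : ℝ, s t x
      = 2 * F t x * Real.exp (-t) / ((F t x * Real.exp (-t)) ^ 2 + 1))
    (hE : ∀ t x : ℝ, E t x = Real.exp (2 * t))
    (hSm : ∀ t x : ℝ, Sm t x
      = (1 / (2 * Real.sqrt 3)) * c t x - (1 / Real.sqrt 3) * s t x * G t x
        - 1 / Real.sqrt 3)
    (hNc : ∀ t x : ℝ, Nc t x = -((1 / Real.sqrt 3) * s t x * G t x))
    (hSc : ∀ t x : ℝ, Sc t x = -((1 / Real.sqrt 3) * c t x * G t x))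
    (hNm : ∀ t x : ℝ, Nm t x
      = (1 / (2 * Real.sqrt 3)) * s t x + (1 / Real.sqrt 3) * c t x * G t x) :
    ∀ t x : ℝ,
      deriv (fun u => Sm u x) t + E t x * deriv (fun y => Nc t y) x
        = 2 * Real.sqrt 3 * ((Sc t x) ^ 2 - (Nm t x) ^ 2) ∧
      deriv (fun u => Nc u x) t + E t x * deriv (fun y => Sm t y) x = 2 * Nc t x ∧
      deriv (fun u => Sc u x) t - E t x * deriv (fun y => Nm t y) x
        = -(2 * Real.sqrt 3) * (Nm t x * Nc t x + Sm t x * Sc t x) ∧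
      deriv (fun u => Nm u x) t - E t x * deriv (fun y => Sc t y) x
        = 2 * Nm t x + 2 * Real.sqrt 3 * (Sm t x * Nm t x + Nc t x * Sc t x) := by
  intro t x
  obtain ⟨p, hp⟩ : ∃ p : ℝ → ℝ → ℝ, ∀ t x, p t x = F t x * Real.exp (-t) := ⟨_, fun _ _ => rfl⟩
  have hc' : ∀ t x, c t x = (p t x ^ 2 - 1) / (p t x ^ 2 + 1) := fun t x => by rw [hc, hp]
  have hs' : ∀ t x, s t x = 2 * p t x / (p t x ^ 2 + 1) := fun t x => by
    rw [hs, hp, mul_assoc]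
  have hE2 : Real.exp (2 * t) = Real.exp t ^ 2 := by rw [two_mul, Real.exp_add, sq]
  have hf1 : ∀ z, HasDerivAt f (deriv f z) z := fun z =>
    (hf.differentiable (by norm_num) z).hasDerivAt
  have hf2 : ∀ z, HasDerivAt (deriv f) (deriv (deriv f) z) z := fun z =>
    ((hf.iterate_deriv' 1 1).differentiable (by norm_num) z).hasDerivAt
  have hzt : HasDerivAt (fun u => Real.exp (2 * u) - 2 * x) (2 * Real.exp t ^ 2) t := by
    refine (((hasDerivAt_id t).const_mul 2).exp.sub_const (2 * x)).congr_deriv ?_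
    simp only [id, hE2]
    ring
  have hzx : HasDerivAt (fun y => Real.exp (2 * t) - 2 * y) (-2) x := by
    simpa using ((hasDerivAt_id x).const_mul 2).const_sub (Real.exp (2 * t))
  have hpt : HasDerivAt (fun u => p u x) (2 * G t x - p t x) t := by
    simp only [hp, hF, hG]
    refine (((hf1 _).comp t hzt).mul (hasDerivAt_neg t).exp).congr_deriv ?_
    simp only [Function.comp_apply, Real.exp_neg]
    field_simp
    ring
  have hpx : HasDerivAt (fun y => p t y) (-2 * G t x / E t x) x := by
    simp only [hp, hF, hG, hE]
    refine (((hf1 _).comp x hzx).mul_const (Real.exp (-t))).congr_deriv ?_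
    rw [Real.exp_neg, hE2]
    field_simp
  obtain ⟨k, hk⟩ : ∃ k, k = 2 * Real.exp t ^ 3 * deriv (deriv f) (Real.exp (2 * t) - 2 * x) :=
    ⟨_, rfl⟩
  have hGt : HasDerivAt (fun u => G u x) (G t x + k) t := by
    simp only [hG, hk]
    refine ((Real.hasDerivAt_exp t).mul ((hf2 _).comp t hzt)).congr_deriv ?_
    simp only [Function.comp_apply]
    ring
  have hGx : HasDerivAt (fun y => G t y) (-k / E t x) x := by
    simp only [hG, hk, hE]
    refine (((hf2 _).comp x hzx).const_mul (Real.exp t)).congr_deriv ?_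
    rw [hE2]
    field_simp
  have hct := hpt.sq_sub_one_div_sq_add_one
  have hst := hpt.two_mul_div_sq_add_one
  have hcx := hpx.sq_sub_one_div_sq_add_one
  have hsx := hpx.two_mul_div_sq_add_one
  simp only [← hc', ← hs'] at hct hst hcx hsx
  have hE0 : E t x ≠ 0 := by rw [hE]; positivity
  have hps : p t x * (1 - c t x) = s t x := by
    have h0 : p t x ^ 2 + 1 ≠ 0 := by positivity
    rw [hc', hs']
    field_simp
    ring
  obtain ⟨r, hr, hr1, hr2, hr3⟩ : ∃ r : ℝ, r ^ 2 = 1 / 3 ∧ 1 / Real.sqrt 3 = r ∧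
      1 / (2 * Real.sqrt 3) = r / 2 ∧ Real.sqrt 3 = 3 * r := by
    have h3 : Real.sqrt 3 ^ 2 = 3 := Real.sq_sqrt (by norm_num)
    refine ⟨1 / Real.sqrt 3, by rw [div_pow, h3, one_pow], rfl, by field_simp, ?_⟩
    field_simp
    exact h3
  rw [hr1] at hSm hNc hSc hNm
  rw [hr2] at hSm hNm
  have hSmt := ((hct.const_mul (r / 2)).sub ((hst.const_mul r).mul hGt)).sub_const r
  have hSmx := ((hcx.const_mul (r / 2)).sub ((hsx.const_mul r).mul hGx)).sub_const r
  have hNct := ((hst.const_mul r).mul hGt).neg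
  have hNcx := ((hsx.const_mul r).mul hGx).neg
  have hSct := ((hct.const_mul r).mul hGt).neg
  have hScx := ((hcx.const_mul r).mul hGx).neg
  have hNmt := (hst.const_mul (r / 2)).add ((hct.const_mul r).mul hGt)
  have hNmx := (hsx.const_mul (r / 2)).add ((hcx.const_mul r).mul hGx)
  have dSmt := (hSmt.congr_of_eventuallyEq (.of_forall fun u => hSm u x)).deriv
  have dSmx := (hSmx.congr_of_eventuallyEq (.of_forall fun y => hSm t y)).deriv
  have dNct := (hNct.congr_of_eventuallyEq (.of_forall fun u => hNc u x)).deriv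
  have dNcx := (hNcx.congr_of_eventuallyEq (.of_forall fun y => hNc t y)).deriv
  have dSct := (hSct.congr_of_eventuallyEq (.of_forall fun u => hSc u x)).deriv
  have dScx := (hScx.congr_of_eventuallyEq (.of_forall fun y => hSc t y)).deriv
  have dNmt := (hNmt.congr_of_eventuallyEq (.of_forall fun u => hNm u x)).deriv
  have dNmx := (hNmx.congr_of_eventuallyEq (.of_forall fun y => hNm t y)).deriv
  rw [dSmt, dSmx, dNct, dNcx, dSct, dScx, dNmt, dNmx, hr3, hSm, hNc, hSc, hNm]
  clear dSmt dSmx dNct dNcx dSct dScx dNmt dNmx hSmt hSmx hNct hNcx hSct hScx hNmt hNmx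
  clear hct hst hcx hsx hGt hGx hpt hpx
  generalize E t x = e at *
  generalize c t x = c at *
  generalize s t x = s at *
  generalize G t x = g at *
  generalize p t x = p at *
  refine ⟨?_, ?_, ?_, ?_⟩ <;> field_simp <;> grind
end

section
/- Let f : ℝ → ℝ be continuously differentiable and fix x ∈ ℝ. For the transformed Wainwright–Marshman functions determined by f: if f(−2x) = 0, then as t → −∞ the quadruple (Σ̃₋, Ñ_×, Σ̃_×, Ñ₋)(t,x) converges to (−√3/2, 0, 0, 0); if f(−2x) ≠ 0, then as t → −∞ it converges to (−1/(2√3), 0, 0, 0). -/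
open Filter

/-- The argument `e^{2t} − 2x` tends to `−2x` as `t → −∞`. -/
theorem tendsto_exp_two_mul_sub_atBot (x : ℝ) :
    Tendsto (fun t : ℝ => Real.exp (2 * t) - 2 * x) atBot (nhds (-2 * x)) := by
  have h : Tendsto (fun t : ℝ => Real.exp (2 * t)) atBot (nhds 0) :=
    Real.tendsto_exp_atBot.comp (tendsto_id.const_mul_atBot (by norm_num))
  convert h.sub_const (2 * x) using 2
  ring

/-- At a zero of a differentiable `f`, the blow-up factor `e^{-t}` is beaten by the linear
vanishing of `f` along `e^{2t}`. -/
theorem tendsto_mul_exp_neg_atBot_of_eq_zero {f : ℝ → ℝ} {x : ℝ}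
    (hf : DifferentiableAt ℝ f (-2 * x)) (h0 : f (-2 * x) = 0) :
    Tendsto (fun t : ℝ => f (Real.exp (2 * t) - 2 * x) * Real.exp (-t)) atBot (nhds 0) := by
  have hne : Tendsto (fun t : ℝ => Real.exp (2 * t) - 2 * x) atBot
      (nhdsWithin (-2 * x) {-2 * x}ᶜ) := by
    refine tendsto_nhdsWithin_iff.2
      ⟨tendsto_exp_two_mul_sub_atBot x, Eventually.of_forall fun t => ?_⟩
    have := Real.exp_pos (2 * t)
    simp only [Set.mem_compl_iff, Set.mem_singleton_iff]
    intro h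
    linarith
  have hmul := ((hasDerivAt_iff_tendsto_slope.1 hf.hasDerivAt).comp hne).mul
    Real.tendsto_exp_atBot
  rw [mul_zero] at hmul
  refine hmul.congr fun t => ?_
  have he : Real.exp (2 * t) = Real.exp t ^ 2 := by rw [← Real.exp_nat_mul]; norm_num
  have hp := (Real.exp_pos t).ne'
  have hd : Real.exp (2 * t) - 2 * x - -2 * x = Real.exp t ^ 2 := by rw [he]; ring
  simp only [Function.comp_apply, slope_def_field, h0, hd, sub_zero, Real.exp_neg]
  field_simp

/-- Pointwise past limits of the transformed Wainwright–Marshman solution: along a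
fixed timeline `x`, as `t → −∞` the quadruple `(Σ̃₋, Ñ_×, Σ̃_×, Ñ₋)` converges to
`(−√3/2, 0, 0, 0)` at spike points (`f(−2x) = 0`) and to `(−1/(2√3), 0, 0, 0)`
at typical points (`f(−2x) ≠ 0`). -/
theorem transformed_wainwright_marshman_past_limits
    (f : ℝ → ℝ) (hf : ContDiff ℝ 1 f) (x : ℝ)
    (F G c s Sm Nc Sc Nm : ℝ → ℝ → ℝ)
    (hF : ∀ t x : ℝ, F t x = f (Real.exp (2 * t) - 2 * x))
    (hG : ∀ t x : ℝ, G t x = Real.exp t * deriv f (Real.exp (2 * t) - 2 * x))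
    (hc : ∀ t x : ℝ, c t x
      = ((F t x * Real.exp (-t)) ^ 2 - 1) / ((F t x * Real.exp (-t)) ^ 2 + 1))
    (hs : ∀ t x : ℝ, s t x
      = 2 * F t x * Real.exp (-t) / ((F t x * Real.exp (-t)) ^ 2 + 1))
    (hSm : ∀ t x : ℝ, Sm t x
      = (1 / (2 * Real.sqrt 3)) * c t x - (1 / Real.sqrt 3) * s t x * G t x
        - 1 / Real.sqrt 3)
    (hNc : ∀ t x : ℝ, Nc t x = -((1 / Real.sqrt 3) * s t x * G t x))
    (hSc : ∀ t x : ℝ, Sc t x = -((1 / Real.sqrt 3) * c t x * G t x))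
    (hNm : ∀ t x : ℝ, Nm t x
      = (1 / (2 * Real.sqrt 3)) * s t x + (1 / Real.sqrt 3) * c t x * G t x) :
    (f (-2 * x) = 0 →
      Tendsto (fun t => (Sm t x, Nc t x, Sc t x, Nm t x)) atBot
        (nhds (-(Real.sqrt 3 / 2), 0, 0, 0))) ∧
    (f (-2 * x) ≠ 0 →
      Tendsto (fun t => (Sm t x, Nc t x, Sc t x, Nm t x)) atBot
        (nhds (-(1 / (2 * Real.sqrt 3)), 0, 0, 0))) := by
  have hx := tendsto_exp_two_mul_sub_atBot x
  have hG0 : Tendsto (fun t => G t x) atBot (nhds 0) := by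
    simp only [hG]
    simpa using Real.tendsto_exp_atBot.mul
      (((hf.continuous_deriv le_rfl).tendsto (-2 * x)).comp hx)
  have hquad : ∀ l : ℝ, Tendsto (fun t => c t x) atBot (nhds l) →
      Tendsto (fun t => s t x) atBot (nhds 0) →
      Tendsto (fun t => (Sm t x, Nc t x, Sc t x, Nm t x)) atBot
        (nhds ((1 / (2 * Real.sqrt 3)) * l - 1 / Real.sqrt 3, 0, 0, 0)) := by
    intro l hcl hs0
    have hsG := (hs0.const_mul (1 / Real.sqrt 3)).mul hG0
    have hcG := (hcl.const_mul (1 / Real.sqrt 3)).mul hG0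
    simp only [hSm, hNc, hSc, hNm]
    refine Tendsto.prodMk_nhds ?_ (Tendsto.prodMk_nhds ?_ (Tendsto.prodMk_nhds ?_ ?_))
    · simpa using ((hcl.const_mul (1 / (2 * Real.sqrt 3))).sub hsG).sub_const (1 / Real.sqrt 3)
    · simpa using hsG.neg
    · simpa using hcG.neg
    · simpa using (hs0.const_mul (1 / (2 * Real.sqrt 3))).add hcG
  have h3 : Real.sqrt 3 ^ 2 = 3 := Real.sq_sqrt (by norm_num)
  have h3ne : Real.sqrt 3 ≠ 0 := by positivity
  refine ⟨fun h0 => ?_, fun h0 => ?_⟩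
  · have hu : Tendsto (fun t => F t x * Real.exp (-t)) atBot (nhds 0) := by
      simp only [hF]
      exact tendsto_mul_exp_neg_atBot_of_eq_zero (hf.differentiable one_ne_zero _) h0
    convert hquad (-1) ?_ ?_ using 3
    · field_simp
      linarith
    · simp only [hc]
      simpa [Pi.div_def] using ((hu.pow 2).sub_const 1).div ((hu.pow 2).add_const 1) (by norm_num)
    · simp only [hs, mul_assoc]
      simpa [Pi.div_def] using (hu.const_mul 2).div ((hu.pow 2).add_const 1) (by norm_num)
  · have hFl : Tendsto (fun t => F t x) atBot (nhds (f (-2 * x))) := by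
      simp only [hF]
      exact (hf.continuous.tendsto _).comp hx
    have he := Real.tendsto_exp_atBot
    have hden := (hFl.pow 2).add (he.pow 2)
    have hdne : f (-2 * x) ^ 2 + (0 : ℝ) ^ 2 ≠ 0 := by positivity
    convert hquad 1 ?_ ?_ using 3
    · field_simp
      norm_num
    · have hlim := ((hFl.pow 2).sub (he.pow 2)).div hden hdne
      have hl : (f (-2 * x) ^ 2 - (0 : ℝ) ^ 2) / (f (-2 * x) ^ 2 + (0 : ℝ) ^ 2) = 1 := by
        rw [zero_pow two_ne_zero, sub_zero, add_zero, div_self (pow_ne_zero 2 h0)]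
      rw [hl] at hlim
      refine hlim.congr fun t => ?_
      have := Real.exp_pos t
      simp only [hc, Real.exp_neg, Pi.div_apply]
      field_simp
    · have hlim := ((hFl.const_mul 2).mul he).div hden hdne
      rw [mul_zero, zero_div] at hlim
      refine hlim.congr fun t => ?_
      have := Real.exp_pos t
      simp only [hs, Real.exp_neg, Pi.div_apply]
      field_simp
end

section
/- Explicit LRS G₂ dust solution: let Λ > 0, ℓ > 0 be constants and f : ℝ → ℝ a function of x. On the open set of (t,x) where 1 + f(x)·√(Λℓ² + e^{−3t}) > 0, the functions Ω_Λ(t) = Λℓ²/(Λℓ² + e^{−3t}), Ω(t,x) = e^{−3t}/[(Λℓ² + e^{−3t})(1 + f(x)√(Λℓ² + e^{−3t}))], and E(t,x) = e^{−t}/[√(Λℓ² + e^{−3t})·(1 + f(x)√(Λℓ² + e^{−3t}))] satisfy, at each such (t,x): ∂ₜΩ_Λ = 3(1 − Ω_Λ)Ω_Λ; ∂ₜΩ = (3/2)(1 − Ω − 3Ω_Λ)Ω; ∂ₜE = (2 − (3/2)Ω − 3Ω_Λ)E; moreover Σ₊ := (1/2)(1 − Ω − Ω_Λ) equals (1/2)f(x)e^{−3t}/[√(Λℓ²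 + e^{−3t})·(1 + f(x)√(Λℓ² + e^{−3t}))]. -/
/-- The explicit LRS `G₂` dust solution with a positive cosmological constant satisfies
the reduced β-normalized evolution equations, and its shear `Σ₊ = (1/2)(1 − Ω − Ω_Λ)`
has the stated explicit form, at every point where
`1 + f(x)·√(Λℓ² + e^{−3t}) > 0`. -/
theorem explicit_LRS_dust_solution
    (Lam ell : ℝ) (hLam : 0 < Lam) (hell : 0 < ell) (f : ℝ → ℝ)
    (OmL : ℝ → ℝ) (Om E : ℝ → ℝ → ℝ)
    (hOmL : ∀ t : ℝ, OmL t
      = Lam * ell ^ 2 / (Lam * ell ^ 2 + Real.exp (-3 * t)))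
    (hOm : ∀ t x : ℝ, Om t x
      = Real.exp (-3 * t) / ((Lam * ell ^ 2 + Real.exp (-3 * t)) *
          (1 + f x * Real.sqrt (Lam * ell ^ 2 + Real.exp (-3 * t)))))
    (hE : ∀ t x : ℝ, E t x
      = Real.exp (-t) / (Real.sqrt (Lam * ell ^ 2 + Real.exp (-3 * t)) *
          (1 + f x * Real.sqrt (Lam * ell ^ 2 + Real.exp (-3 * t))))) :
    ∀ t x : ℝ, 0 < 1 + f x * Real.sqrt (Lam * ell ^ 2 + Real.exp (-3 * t)) →
      deriv OmL t = 3 * (1 - OmL t) * OmL t ∧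
      deriv (fun u => Om u x) t = (3 / 2) * (1 - Om t x - 3 * OmL t) * Om t x ∧
      deriv (fun u => E u x) t = (2 - (3 / 2) * Om t x - 3 * OmL t) * E t x ∧
      (1 / 2) * (1 - Om t x - OmL t)
        = (1 / 2) * f x * Real.exp (-3 * t) /
            (Real.sqrt (Lam * ell ^ 2 + Real.exp (-3 * t)) *
              (1 + f x * Real.sqrt (Lam * ell ^ 2 + Real.exp (-3 * t)))) := by
  intro t x hpos
  have hA : 0 < Lam * ell ^ 2 := by positivity
  have hOmL_fun : OmL = fun u => Lam * ell ^ 2 / (Lam * ell ^ 2 + Real.exp (-3 * u)) :=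
    funext hOmL
  have hexp3 : HasDerivAt (fun u : ℝ => Real.exp (-3 * u)) (Real.exp (-3 * t) * -3) t := by
    simpa using ((hasDerivAt_id t).const_mul (-3 : ℝ)).exp
  have hexp1 : HasDerivAt (fun u : ℝ => Real.exp (-u)) (Real.exp (-t) * -1) t :=
    (hasDerivAt_neg t).exp
  have hsum : HasDerivAt (fun u : ℝ => Lam * ell ^ 2 + Real.exp (-3 * u))
      (Real.exp (-3 * t) * -3) t := hexp3.const_add _
  have hsum_pos : 0 < Lam * ell ^ 2 + Real.exp (-3 * t) := by positivity
  have hsqrt := hsum.sqrt hsum_pos.ne'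
  have hden := (hsqrt.const_mul (f x)).const_add 1
  have hS : 0 < Real.sqrt (Lam * ell ^ 2 + Real.exp (-3 * t)) := Real.sqrt_pos.2 hsum_pos
  have hS2 : Lam * ell ^ 2 + Real.exp (-3 * t)
      = Real.sqrt (Lam * ell ^ 2 + Real.exp (-3 * t)) ^ 2 := (Real.sq_sqrt hsum_pos.le).symm
  have dOmL := ((hasDerivAt_const t (Lam * ell ^ 2)).div hsum hsum_pos.ne').deriv
  have dOm := (hexp3.div (hsum.mul hden) (mul_pos hsum_pos hpos).ne').deriv
  have dE := (hexp1.div (hsqrt.mul hden) (mul_pos hS hpos).ne').deriv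
  simp only [Pi.div_def, Pi.mul_def] at dOmL dOm dE
  simp only [hOm, hE, hOmL_fun]
  rw [dOmL, dOm, dE]
  generalize Real.sqrt (Lam * ell ^ 2 + Real.exp (-3 * t)) = S at *
  generalize Real.exp (-3 * t) = e at *
  generalize Real.exp (-t) = g at *
  generalize Lam * ell ^ 2 = A at *
  generalize f x = c at *
  obtain rfl : A = S ^ 2 - e := by linarith
  simp only [sub_add_cancel] at *
  have hD : 1 + S * c ≠ 0 := by rw [mul_comm]; exact hpos.ne'
  have hS0 := hS.ne'
  refine ⟨?_, ?_, ?_, ?_⟩ <;> field_simp <;> ring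
end

section
/- Let L > 0 and f be real constants, and define Σ₊ᴴ(t) = e^{−3t}·f / [2√(L + e^{−3t}) + f·(2L + e^{−3t})]. (a) If f > 0, then Σ₊ᴴ(t) → 1 as t → −∞. (b) If f = 0, then Σ₊ᴴ(t) = 0 for all t. (c) If f < 0 and f²·L < 1, then, with t_s := −(1/3)·ln(f^{−2} − L), Σ₊ᴴ(t) → −1 as t → t_s from the right. -/
open Filter

/-- Asymptotics of the Hubble-normalized shear `Σ₊ᴴ` of the explicit LRS `G₂` dust
solution along a fixed timeline: it tends to `1` (LRS Kasner) as `t → −∞` if `f > 0`,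
vanishes identically if `f = 0`, and tends to `−1` (Taub Kasner) as `t → t_s⁺`
if `f < 0` with `f²L < 1`. -/
theorem LRS_dust_hubble_shear_limits
    (L f : ℝ) (hL : 0 < L) (SpH : ℝ → ℝ)
    (hSpH : ∀ t : ℝ, SpH t
      = Real.exp (-3 * t) * f /
          (2 * Real.sqrt (L + Real.exp (-3 * t)) + f * (2 * L + Real.exp (-3 * t)))) :
    (0 < f → Tendsto SpH atBot (nhds 1)) ∧
    (f = 0 → ∀ t : ℝ, SpH t = 0) ∧
    (f < 0 → f ^ 2 * L < 1 →
      Tendsto SpH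
        (nhdsWithin (-(1 / 3) * Real.log (f⁻¹ ^ 2 - L))
          (Set.Ioi (-(1 / 3) * Real.log (f⁻¹ ^ 2 - L))))
        (nhds (-1))) := by
  refine ⟨fun hf => ?_, fun hf t => by simp [hSpH, hf], fun hf hfL => ?_⟩
  · -- In terms of `v = exp (3 * t) → 0` the shear is a function continuous at `v = 0`.
    have h_eq : SpH = (fun v : ℝ => f / (2 * √(L * v ^ 2 + v) + f * (2 * L * v + 1))) ∘
        fun t => Real.exp (3 * t) := by
      funext t
      have hv : 0 < Real.exp (3 * t) := Real.exp_pos _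
      have hu : Real.exp (-3 * t) = (Real.exp (3 * t))⁻¹ := by
        rw [← Real.exp_neg, neg_mul]
      rw [hSpH, hu, Function.comp_apply]
      generalize Real.exp (3 * t) = v at hv
      have h_sqrt : √(L * v ^ 2 + v) = v * √(L + v⁻¹) := by
        rw [show L * v ^ 2 + v = v ^ 2 * (L + v⁻¹) by field_simp,
          Real.sqrt_mul (sq_nonneg v), Real.sqrt_sq hv.le]
      have h_den : 2 * (v * √(L + v⁻¹)) + f * (2 * L * v + 1)
          = v * (2 * √(L + v⁻¹) + f * (2 * L + v⁻¹)) := by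
        field_simp
      rw [h_sqrt, h_den, ← div_div, div_eq_inv_mul f v]
    have h_exp : Tendsto (fun t : ℝ => Real.exp (3 * t)) atBot (nhds 0) :=
      Real.tendsto_exp_atBot.comp (tendsto_id.const_mul_atBot (by norm_num))
    have h_cont : ContinuousAt
        (fun v : ℝ => f / (2 * √(L * v ^ 2 + v) + f * (2 * L * v + 1))) 0 :=
      ContinuousAt.div (by fun_prop) (by fun_prop) (by simp [hf.ne'])
    have h_lim := h_cont.tendsto.comp h_exp
    rw [← h_eq] at h_lim
    simpa [hf.ne'] using h_lim
  · -- The denominator does not vanish at `t_s`, so the limit is the value there.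
    have hf0 : f ≠ 0 := hf.ne
    have h_pos : 0 < f⁻¹ ^ 2 - L := by
      have h : f⁻¹ ^ 2 - L = (1 - f ^ 2 * L) / f ^ 2 := by field_simp
      rw [h]
      exact div_pos (by linarith) (by positivity)
    set s := -(1 / 3) * Real.log (f⁻¹ ^ 2 - L) with hs
    have h_exp : Real.exp (-3 * s) = f⁻¹ ^ 2 - L := by
      rw [hs, show -3 * (-(1 / 3) * Real.log (f⁻¹ ^ 2 - L)) = Real.log (f⁻¹ ^ 2 - L) by ring,
        Real.exp_log h_pos]
    have h_sqrt : √(L + Real.exp (-3 * s)) = -f⁻¹ := by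
      rw [h_exp, add_sub_cancel, Real.sqrt_sq_eq_abs, abs_of_neg (inv_lt_zero.mpr hf)]
    have h_den : 2 * √(L + Real.exp (-3 * s)) + f * (2 * L + Real.exp (-3 * s))
        = -(Real.exp (-3 * s) * f) := by
      rw [h_sqrt, h_exp]
      field_simp
      ring
    have h_num : Real.exp (-3 * s) * f ≠ 0 := mul_ne_zero (Real.exp_ne_zero _) hf0
    have h_cont : ContinuousAt SpH s := by
      rw [funext hSpH]
      exact ContinuousAt.div (by fun_prop) (by fun_prop) (h_den ▸ neg_ne_zero.mpr h_num)
    have h_val : SpH s = -1 := by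
      rw [hSpH, h_den, div_neg, div_self h_num]
    exact h_val ▸ h_cont.tendsto.mono_left nhdsWithin_le_nhds
end

section
/- Propagation of the Gauss constraint: if (Σ₊, Σ₋, N₁₁, N₂₂, N₃₃) : ℝ → ℝ⁵ is a differentiable solution of the vacuum Bianchi VIII/IX evolution system, then the function G(t) := 1 − Ω_k(t) − Σ₊(t)² − Σ₋(t)², where Ω_k = (1/12)[N₁₁² + N₂₂² + N₃₃² − 2(N₁₁N₂₂ + N₂₂N₃₃ + N₃₃N₁₁)], satisfies G'(t) = 2·q(t)·G(t) for all t, with q = 2(Σ₊² + Σ₋²). -/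
/-- Propagation of the Gauss constraint along solutions of the vacuum Bianchi VIII/IX
evolution system: `G := 1 − Ω_k − Σ₊² − Σ₋²` satisfies `G' = 2qG`. -/
theorem gauss_constraint_propagation
    (Sp Sm N11 N22 N33 : ℝ → ℝ)
    (hSp : Differentiable ℝ Sp) (hSm : Differentiable ℝ Sm)
    (hN11 : Differentiable ℝ N11) (hN22 : Differentiable ℝ N22)
    (hN33 : Differentiable ℝ N33)
    (q : ℝ → ℝ) (hq : ∀ t : ℝ, q t = 2 * ((Sp t) ^ 2 + (Sm t) ^ 2))
    (e1 : ∀ t : ℝ, deriv Sp t = (q t - 2) * Sp t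
      - (1 / 6) * ((N22 t - N33 t) ^ 2 - N11 t * (2 * N11 t - N22 t - N33 t)))
    (e2 : ∀ t : ℝ, deriv Sm t = (q t - 2) * Sm t
      - (1 / (2 * Real.sqrt 3)) * (N33 t - N22 t) * (N11 t - N22 t - N33 t))
    (e3 : ∀ t : ℝ, deriv N11 t = (q t - 4 * Sp t) * N11 t)
    (e4 : ∀ t : ℝ, deriv N22 t = (q t + 2 * Sp t + 2 * Real.sqrt 3 * Sm t) * N22 t)
    (e5 : ∀ t : ℝ, deriv N33 t = (q t + 2 * Sp t - 2 * Real.sqrt 3 * Sm t) * N33 t)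
    (Omk G : ℝ → ℝ)
    (hOmk : ∀ t : ℝ, Omk t = (1 / 12) * ((N11 t) ^ 2 + (N22 t) ^ 2 + (N33 t) ^ 2
      - 2 * (N11 t * N22 t + N22 t * N33 t + N33 t * N11 t)))
    (hG : ∀ t : ℝ, G t = 1 - Omk t - (Sp t) ^ 2 - (Sm t) ^ 2) :
    ∀ t : ℝ, deriv G t = 2 * q t * G t := by
  intro t
  have hs : (1 : ℝ) / (2 * Real.sqrt 3) = Real.sqrt 3 / 6 := by
    rw [div_eq_div_iff (by positivity) (by norm_num)]
    linear_combination (-2) * Real.mul_self_sqrt (show (0 : ℝ) ≤ 3 by norm_num)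
  have dP := (hSp t).hasDerivAt
  have dM := (hSm t).hasDerivAt
  have d1 := (hN11 t).hasDerivAt
  have d2 := (hN22 t).hasDerivAt
  have d3 := (hN33 t).hasDerivAt
  have hGfun : G = fun x => 1 - (1 / 12) * (N11 x ^ 2 + N22 x ^ 2 + N33 x ^ 2
      - 2 * (N11 x * N22 x + N22 x * N33 x + N33 x * N11 x)) - Sp x ^ 2 - Sm x ^ 2 := by
    funext x
    rw [hG, hOmk]
  have dOmk := ((((d1.fun_pow 2).fun_add (d2.fun_pow 2)).fun_add (d3.fun_pow 2)).fun_sub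
    ((((d1.fun_mul d2).fun_add (d2.fun_mul d3)).fun_add (d3.fun_mul d1)).const_mul 2)).const_mul
      (1 / 12 : ℝ)
  have dG := ((dOmk.const_sub 1).fun_sub (dP.fun_pow 2)).fun_sub (dM.fun_pow 2)
  rw [← hGfun] at dG
  rw [dG.deriv, hG, hOmk, e1, e2, e3, e4, e5, hs, hq]
  push_cast
  ring
end

section
/- Bianchi VII tilt proposition: let n be a real symmetric 2×2 matrix with det n > 0, let σ ∈ ℝ² be nonzero, let v ∈ ℝ², a₁ ∈ ℝ and c > 0. Set ñ = n − (1/2)(tr n)·I and *ñ = εñ, where ε is the matrix with ε₁₂ = 1, ε₂₁ = −1, ε₁₁ = ε₂₂ = 0. If the Codazzi constraint holds componentwise, namely c·v = 3a₁·σ + (*ñ + (1/2)(tr n)·ε)·σ, then v₁σ₂ − v₂σ₁ ≠ 0. -/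
open Matrix

/-- The quadratic form of a real symmetric `2 × 2` matrix with positive determinant is
anisotropic. -/
theorem dotProduct_mulVec_ne_zero_of_det_pos {n : Matrix (Fin 2) (Fin 2) ℝ} (hn : n.IsSymm)
    (hdet : 0 < n.det) {x : Fin 2 → ℝ} (hx : x ≠ 0) : x ⬝ᵥ n *ᵥ x ≠ 0 := by
  intro h
  have hs : n 1 0 = n 0 1 := hn.apply 0 1
  rw [det_fin_two, hs] at hdet
  simp only [dotProduct, mulVec, Fin.sum_univ_two, hs] at h
  have hsq : (n 0 0 * x 0 + n 0 1 * x 1) ^ 2 +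
      (n 0 0 * n 1 1 - n 0 1 * n 0 1) * x 1 ^ 2 = 0 := by
    linear_combination n 0 0 * h
  have h1 : x 1 = 0 := by
    by_contra h1
    have : 0 < (n 0 0 * n 1 1 - n 0 1 * n 0 1) * x 1 ^ 2 := by positivity
    linarith [sq_nonneg (n 0 0 * x 0 + n 0 1 * x 1)]
  have hn0 : n 0 0 ≠ 0 := by
    intro h0
    rw [h0] at hdet
    linarith [mul_self_nonneg (n 0 1)]
  have h0 : x 0 = 0 := by simpa [h1, hn0] using hsq
  exact hx (by ext i; fin_cases i <;> assumption)

/-- Bianchi VII tilt proposition: if `n` is symmetric with `det n > 0`, `σ ≠ 0`,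
`c > 0`, and the Codazzi constraint `c·v = 3a₁·σ + (*ñ + (1/2)(tr n)·ε)·σ` holds,
then the tilt vector is not parallel to the off-diagonal shear vector:
`v₁σ₂ − v₂σ₁ ≠ 0`. -/
theorem bianchi_VII_tilt_not_parallel
    (n : Matrix (Fin 2) (Fin 2) ℝ) (hn : n.IsSymm) (hdet : 0 < n.det)
    (sig v : Fin 2 → ℝ) (hsig : sig ≠ 0) (a1 c : ℝ) (hc : 0 < c)
    (hcod : c • v = (3 * a1) • sig +
      ((!![(0 : ℝ), 1; -1, 0] * (n - (n.trace / 2) • (1 : Matrix (Fin 2) (Fin 2) ℝ))) +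
        (n.trace / 2) • !![(0 : ℝ), 1; -1, 0]).mulVec sig) :
    v 0 * sig 1 - v 1 * sig 0 ≠ 0 := by
  have h0 := congrFun hcod 0
  have h1 := congrFun hcod 1
  simp only [Pi.smul_apply, Pi.add_apply, smul_eq_mul, mulVec, dotProduct, Fin.sum_univ_two,
    Matrix.add_apply, Matrix.sub_apply, Matrix.smul_apply, Matrix.mul_apply, of_apply, cons_val_zero,
    cons_val_one, one_apply_eq, ne_eq, zero_ne_one, one_ne_zero, not_false_eq_true,
    one_apply_ne] at h0 h1
  have key : c * (v 0 * sig 1 - v 1 * sig 0) = sig ⬝ᵥ n *ᵥ sig := by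
    simp only [dotProduct, mulVec, Fin.sum_univ_two]
    linear_combination sig 1 * h0 - sig 0 * h1
  intro h
  rw [h, mul_zero] at key
  exact dotProduct_mulVec_ne_zero_of_det_pos hn hdet hsig key.symm
end
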